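/- arXiv:2104.09819 — 3 statements merged into one kernel-verified Lean document; each statement's English description precedes it below -/
import Mathlib

section
/- Suppose $(X,\mathcal{A},\mu)$ is a measure space, $(f_{m,n})_{m,n=1}^\infty$ is a double sequence of complex-valued measurable functions on $X$, $(g_m)_{m=1}^\infty$ is a sequence of complex-valued measurable functions on $X$ and $h$ is a complex-valued measurable function on $X$. Suppose for each $m \in \mathbb{N}$, $f_{m,n} \to g_m$ almost uniformly as $n \to \infty$, and $g_m \to h$ almost uniformly as $m \to \infty$. Then there is a strictly increasing sequence $(n_m)_{m=1}^\infty$ of natural numbers such that $f_{m,n_m} \to h$ almost uniformly as $m \to \infty$. -/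
open Filter Topology MeasureTheory

/-- Almost uniform convergence: for every `ε > 0` there is a measurable set `A`
with `μ A < ε` such that the sequence converges uniformly on `X \ A`. -/
def TendstoAlmostUniformly {X : Type*} [MeasurableSpace X] (μ : Measure X)
    (f : ℕ → X → ℂ) (g : X → ℂ) : Prop :=
  ∀ ε : ENNReal, 0 < ε → ∃ A : Set X, MeasurableSet A ∧ μ A < ε ∧
    TendstoUniformlyOn f g atTop Aᶜ

/-- If each sequence `f m` converges almost uniformly to `g m`, then `f m n` is within
`1 / (m + 1)` of `g m` for large `n`, off exceptional sets whose measures have finite sum. -/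
theorem exists_summable_exceptional_sets {X : Type*} [MeasurableSpace X] {μ : Measure X}
    {f : ℕ → ℕ → X → ℂ} {g : ℕ → X → ℂ}
    (hfg : ∀ m : ℕ, TendstoAlmostUniformly μ (fun n => f m n) (g m)) :
    ∃ (A : ℕ → Set X) (N : ℕ → ℕ), (∀ m, MeasurableSet (A m)) ∧ ∑' m, μ (A m) ≠ ⊤ ∧
      ∀ m n, N m ≤ n → ∀ x ∉ A m, dist (g m x) (f m n x) < 1 / ((m : ℝ) + 1) := by
  obtain ⟨δ, hδ, hsum⟩ := ENNReal.exists_pos_sum_of_countable one_ne_zero ℕ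
  choose A hA hμA hunif using fun m => hfg m (δ m) (by exact_mod_cast hδ m)
  choose N hN using fun m => eventually_atTop.1
    (Metric.tendstoUniformlyOn_iff.1 (hunif m) (1 / ((m : ℝ) + 1)) Nat.one_div_pos_of_nat)
  exact ⟨A, N, hA, ((ENNReal.tsum_le_tsum fun m => (hμA m).le).trans_lt
    (hsum.trans ENNReal.one_lt_top)).ne, fun m n hn x hx => hN m n hn x hx⟩

/-- Every sequence of natural numbers is bounded above by a strictly increasing one. -/
theorem exists_strictMono_nat_ge (N : ℕ → ℕ) : ∃ n : ℕ → ℕ, StrictMono n ∧ ∀ m, N m ≤ n m := by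
  refine ⟨fun m => m + ∑ i ∈ Finset.range (m + 1), N i, strictMono_nat_of_lt_succ fun m => ?_,
    fun m => ?_⟩
  · simp only [Finset.sum_range_succ _ (m + 1)]
    lia
  · simp only [Finset.sum_range_succ _ m]
    lia

theorem stmt_3 {X : Type*} [MeasurableSpace X] (μ : Measure X)
    (f : ℕ → ℕ → X → ℂ) (g : ℕ → X → ℂ) (h : X → ℂ)
    (hf : ∀ m n, Measurable (f m n)) (hg : ∀ m, Measurable (g m)) (hh : Measurable h)
    (hfg : ∀ m : ℕ, TendstoAlmostUniformly μ (fun n => f m n) (g m))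
    (hgh : TendstoAlmostUniformly μ g h) :
    ∃ n : ℕ → ℕ, StrictMono n ∧
      TendstoAlmostUniformly μ (fun m => f m (n m)) h := by
  obtain ⟨A, N, hA, hsum, hN⟩ := exists_summable_exceptional_sets hfg
  obtain ⟨n, hn, hNn⟩ := exists_strictMono_nat_ge N
  refine ⟨n, hn, fun ε hε => ?_⟩
  have hε2 : 0 < ε / 2 := ENNReal.half_pos hε.ne'
  obtain ⟨B, hB, hμB, hunif⟩ := hgh (ε / 2) hε2
  obtain ⟨M, hM⟩ := ((ENNReal.tendsto_sum_nat_add _ hsum).eventually_lt_const hε2).exists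
  refine ⟨B ∪ ⋃ k, A (k + M), hB.union (.iUnion fun k => hA _), ?_, ?_⟩
  · calc μ (B ∪ ⋃ k, A (k + M)) ≤ μ B + ∑' k, μ (A (k + M)) :=
          (measure_union_le _ _).trans (by gcongr; exact measure_iUnion_le _)
      _ < ε / 2 + ε / 2 := ENNReal.add_lt_add hμB hM
      _ = ε := ENNReal.add_halves ε
  · rw [Metric.tendstoUniformlyOn_iff] at hunif ⊢
    intro η hη
    filter_upwards [hunif (η / 2) (half_pos hη), eventually_ge_atTop M,
      tendsto_one_div_add_atTop_nhds_zero_nat.eventually_lt_const (half_pos hη)]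
      with m hgm hMm hm x hx
    simp only [Set.mem_compl_iff, Set.mem_union, Set.mem_iUnion, not_or, not_exists] at hx
    have hxA : x ∉ A m := by simpa [Nat.sub_add_cancel hMm] using hx.2 (m - M)
    linarith [dist_triangle (h x) (g m x) (f m (n m) x), hgm x hx.1, hN m (n m) (hNn m) x hxA]
end

section
/- Suppose $(X,\mathcal{A},\mu)$ is a $\sigma$-finite measure space, $(f_{m,n})_{m,n=1}^\infty$ is a double sequence of complex-valued measurable functions on $X$, $(g_m)_{m=1}^\infty$ is a sequence of complex-valued measurable functions on $X$ and $h$ is a complex-valued measurable function on $X$. Suppose for each $m \in \mathbb{N}$, $f_{m,n} \to g_m$ $\mu$-almost everywhere as $n \to \infty$, and $g_m \to h$ $\mu$-almost everywhere as $m \to \infty$. Then there is a strictly increasing sequence $(n_m)_{m=1}^\infty$ of natural numbers such that $f_{m,n_m} \to h$ $\mu$-almost everywhere as $m \to \infty$. -/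
open Filter Topology MeasureTheory

theorem stmt_4 {X : Type*} [MeasurableSpace X] (μ : Measure X) [SigmaFinite μ]
    (f : ℕ → ℕ → X → ℂ) (g : ℕ → X → ℂ) (h : X → ℂ)
    (hf : ∀ m n, Measurable (f m n)) (hg : ∀ m, Measurable (g m)) (hh : Measurable h)
    (hfg : ∀ m : ℕ, ∀ᵐ x ∂μ, Tendsto (fun n => f m n x) atTop (𝓝 (g m x)))
    (hgh : ∀ᵐ x ∂μ, Tendsto (fun m => g m x) atTop (𝓝 (h x))) :
    ∃ n : ℕ → ℕ, StrictMono n ∧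
      ∀ᵐ x ∂μ, Tendsto (fun m => f m (n m) x) atTop (𝓝 (h x)) := by
  have hmeas : ∀ m, TendstoInMeasure μ.toFinite (f m) atTop (g m) := fun m =>
    tendstoInMeasure_of_tendsto_ae (fun n => (hf m n).aestronglyMeasurable)
      (by rw [ae_toFinite]; exact hfg m)
  obtain ⟨n, hn, hbound⟩ := extraction_forall_of_eventually fun m =>
    eventually_atTop.2 (ExistsSeqTendstoAe.exists_nat_measure_lt_two_inv (hmeas m) m)
  refine ⟨n, hn, ?_⟩
  have hsum : ∑' m, μ.toFinite {x | (2 : ENNReal)⁻¹ ^ m ≤ edist (f m (n m) x) (g m x)} ≠ ⊤ := by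
    refine ne_top_of_le_ne_top ?_ (ENNReal.tsum_le_tsum hbound)
    simp [ENNReal.tsum_geometric]
  have hclose := ae_eventually_notMem hsum
  rw [ae_toFinite] at hclose
  filter_upwards [hclose, hgh] with x hx hgx
  have hdist : Tendsto (fun m => edist (f m (n m) x) (g m x)) atTop (𝓝 0) := by
    refine tendsto_of_tendsto_of_tendsto_of_le_of_le' tendsto_const_nhds
      (ENNReal.tendsto_pow_atTop_nhds_zero_of_lt_one (r := 2⁻¹) (by simp))
      (Eventually.of_forall fun _ => zero_le) ?_
    filter_upwards [hx] with m hm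
    exact (not_le.1 hm).le
  rw [tendsto_iff_edist_tendsto_0] at hgx ⊢
  exact tendsto_of_tendsto_of_tendsto_of_le_of_le tendsto_const_nhds
    (by simpa using hdist.add hgx) (fun _ => zero_le) fun _ => edist_triangle _ _ _
end

section
/- A pointwise limit of a sequence of continuous real-valued functions on $\mathbb{R}$ (a Baire class 1 function) has a meager set of points of discontinuity; in particular, since $\mathbb{R}$ is a Baire space, such a limit cannot be discontinuous everywhere, and hence the indicator function $1_{\mathbb{Q}}$ is not a pointwise limit of continuous functions $\mathbb{R} \to \mathbb{R}$. -/
open Filter Topology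

/-- The set of discontinuities of a pointwise limit of continuous functions into a
pseudometric space is meagre. -/
theorem isMeagre_setOf_not_continuousAt_of_tendsto {X Y : Type*} [TopologicalSpace X]
    [PseudoMetricSpace Y] {f : ℕ → X → Y} {u : X → Y} (hf : ∀ n, Continuous (f n))
    (hu : ∀ x, Tendsto (fun n => f n x) atTop (𝓝 (u x))) :
    IsMeagre {x | ¬ ContinuousAt u x} := by
  let A : ℕ → ℕ → Set X := fun k N =>
    {x | ∀ n ≥ N, dist (f n x) (f N x) ≤ 1 / ((k : ℝ) + 1)}
  have hA : ∀ k N, IsClosed (A k N) := fun k N => by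
    simp only [A, Set.ofPred_forall]
    exact isClosed_iInter fun n => isClosed_iInter fun _ =>
      isClosed_le ((hf n).dist (hf N)) continuous_const
  have hmeagre : IsMeagre (⋃ k, ⋃ N, frontier (A k N)) :=
    isMeagre_iUnion fun k => isMeagre_iUnion fun N =>
      (isClosed_frontier.isNowhereDense_iff.2 (interior_frontier (hA k N))).isMeagre
  refine hmeagre.mono fun x hx => ?_
  by_contra hxA
  simp only [Set.mem_iUnion, not_exists] at hxA
  refine hx (continuousAt_of_locally_uniform_approx_of_continuousAt fun U hU => ?_)
  obtain ⟨ε, hε, hεU⟩ := Metric.mem_uniformity_dist.1 hU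
  obtain ⟨k, hk⟩ := exists_nat_one_div_lt hε
  obtain ⟨N, hN⟩ := Metric.cauchySeq_iff'.1 (hu x).cauchySeq _ (Nat.one_div_pos_of_nat (n := k))
  have hxint : x ∈ interior (A k N) := by
    by_contra hxint
    exact hxA k N ⟨subset_closure fun n hn => (hN n hn).le, hxint⟩
  refine ⟨A k N, mem_interior_iff_mem_nhds.1 hxint, f N, (hf N).continuousAt, fun y hy => ?_⟩
  refine hεU (lt_of_le_of_lt ?_ hk)
  exact le_of_tendsto ((hu y).dist tendsto_const_nhds) (eventually_atTop.2 ⟨N, hy⟩)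

/-- The indicator of a dense set with dense complement is nowhere continuous. -/
theorem Dense.not_continuousAt_indicator_one {X : Type*} [TopologicalSpace X] {s : Set X}
    (hs : Dense s) (hsc : Dense sᶜ) (x : X) : ¬ ContinuousAt (s.indicator (1 : X → ℝ)) x := by
  intro h
  have h1 : s.indicator (1 : X → ℝ) x ∈ closure {1} :=
    h.continuousWithinAt.mem_closure (hs x) fun y hy => by simp [hy]
  have h0 : s.indicator (1 : X → ℝ) x ∈ closure {0} :=
    h.continuousWithinAt.mem_closure (hsc x) fun y hy => Set.indicator_of_notMem hy _
  rw [closure_singleton, Set.mem_singleton_iff] at h0 h1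
  exact one_ne_zero (h1.symm.trans h0)

theorem stmt_11 :
    (∀ (f : ℕ → ℝ → ℝ) (u : ℝ → ℝ), (∀ n, Continuous (f n)) →
      (∀ x : ℝ, Tendsto (fun n => f n x) atTop (𝓝 (u x))) →
      IsMeagre {x : ℝ | ¬ ContinuousAt u x}) ∧
    ¬ ∃ f : ℕ → ℝ → ℝ, (∀ n, Continuous (f n)) ∧
      ∀ x : ℝ, Tendsto (fun n => f n x) atTop
        (𝓝 (Set.indicator {x : ℝ | ∃ r : ℚ, (r : ℝ) = x} 1 x)) := by
  refine ⟨fun f u hf hu => isMeagre_setOf_not_continuousAt_of_tendsto hf hu, ?_⟩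
  rintro ⟨f, hf, hu⟩
  refine not_isMeagre_of_isOpen isOpen_univ Set.univ_nonempty
    ((isMeagre_setOf_not_continuousAt_of_tendsto hf hu).mono fun x _ => ?_)
  exact Dense.not_continuousAt_indicator_one Rat.denseRange_cast dense_irrational x
end
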